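/- arXiv:1701.07106 — 3 statements merged into one kernel-verified Lean document; each statement's English description precedes it below -/
import Mathlib

section
/- In a system satisfying Restricted Case II with initial failure set E' ⊆ E, for every set X ⊆ E of hardened entities, the protection set of X equals the union of the individual protection sets of its members: P(X|E') = ⋃_{e ∈ X} P(e|E'). -/
open Finset

/-- An Implicative Interdependency Model (IIM) system on a finite entity set `α`.
`idr e` is the (finite) set of minterms of the IDR of entity `e`;
`idr e = ∅` means that `e` has no IDR.  Each minterm is a nonempty subset of
the entities not containing `e` itself. -/
structure IIM (α : Type*) [Fintype α] [DecidableEq α] where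
  idr : α → Finset (Finset α)
  minterm_nonempty : ∀ e s, s ∈ idr e → s.Nonempty
  minterm_not_self : ∀ e s, s ∈ idr e → e ∉ s

namespace IIM

variable {α : Type*} [Fintype α] [DecidableEq α]

/-- The cascading-failure sequence `D_t` with initial failure set `S` and
hardened set `H`: `D_0 = S \ H` and `D_{t+1} = D_t ∪ {e ∈ E \ H : e has an IDR
and every minterm of its IDR contains some entity of D_t}`. -/
def cascade (sys : IIM α) (S H : Finset α) : ℕ → Finset α
  | 0 => S \ H
  | t + 1 =>
    let D := sys.cascade S H t
    D ∪ Finset.univ.filter fun e =>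
      e ∉ H ∧ (sys.idr e).Nonempty ∧ ∀ s ∈ sys.idr e, ∃ d ∈ D, d ∈ s

/-- `KillSet_H(S)`: the eventual (stable) value of the cascade, reached by
time step `|E| - 1`. -/
def killSetH (sys : IIM α) (S H : Finset α) : Finset α :=
  sys.cascade S H (Fintype.card α - 1)

/-- `KillSet(S) = KillSet_∅(S)`. -/
def killSet (sys : IIM α) (S : Finset α) : Finset α := sys.killSetH S ∅

/-- The protection set `P(X|E') = KillSet(E') \ KillSet_X(E')`. -/
def protSet (sys : IIM α) (X E' : Finset α) : Finset α :=
  sys.killSet E' \ sys.killSetH E' X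

/-- Restricted Case I: every IDR consists of exactly one minterm, of size one. -/
def RestrictedI (sys : IIM α) : Prop :=
  (∀ e, (sys.idr e).card ≤ 1) ∧ ∀ e s, s ∈ sys.idr e → s.card = 1

/-- Restricted Case II: every minterm of every IDR has size one. -/
def RestrictedII (sys : IIM α) : Prop :=
  ∀ e s, s ∈ sys.idr e → s.card = 1

end IIM

theorem IIM.cascade_succ_iff {α : Type*} [Fintype α] [DecidableEq α]
    (sys : IIM α) (S H : Finset α) (t : ℕ) (x : α) :
    x ∈ sys.cascade S H (t + 1) ↔ x ∉ H ∧ (x ∈ S ∨ ((sys.idr x).Nonempty ∧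
      ∀ s ∈ sys.idr x, ∃ d ∈ sys.cascade S H t, d ∈ s)) := by
  induction t generalizing x with
  | zero =>
    simp only [IIM.cascade, mem_union, mem_filter, mem_univ, true_and, mem_sdiff]
    tauto
  | succ t ih =>
    have step : ∀ n y, y ∈ sys.cascade S H (n + 1) ↔ y ∈ sys.cascade S H n ∨
        (y ∉ H ∧ (sys.idr y).Nonempty ∧ ∀ s ∈ sys.idr y, ∃ d ∈ sys.cascade S H n, d ∈ s) := by
      intro n y
      simp [IIM.cascade]
    have mono : ∀ y, y ∈ sys.cascade S H t → y ∈ sys.cascade S H (t + 1) :=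
      fun y hy => (step t y).2 (Or.inl hy)
    constructor
    · intro h
      rcases (step (t + 1) x).1 h with h | h
      · obtain ⟨h1, h2⟩ := (ih x).1 h
        refine ⟨h1, h2.imp id fun h3 => ⟨h3.1, fun s hs => ?_⟩⟩
        obtain ⟨d, hd, hds⟩ := h3.2 s hs
        exact ⟨d, mono d hd, hds⟩
      · exact ⟨h.1, Or.inr h.2⟩
    · rintro ⟨h1, h2 | h2⟩
      · exact (step (t + 1) x).2 (Or.inl ((ih x).2 ⟨h1, Or.inl h2⟩))
      · exact (step (t + 1) x).2 (Or.inr ⟨h1, h2⟩)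

theorem IIM.cascade_inter {α : Type*} [Fintype α] [DecidableEq α]
    (sys : IIM α) (hres : sys.RestrictedII) (S X : Finset α) (t : ℕ) (x : α) :
    x ∈ sys.cascade S X t ↔
      x ∈ sys.cascade S ∅ t ∧ ∀ e ∈ X, x ∈ sys.cascade S {e} t := by
  induction t generalizing x with
  | zero =>
    simp only [IIM.cascade, mem_sdiff, mem_singleton, notMem_empty, not_false_eq_true, and_true]
    constructor
    · rintro ⟨h1, h2⟩
      exact ⟨h1, fun e he => ⟨h1, fun h => h2 (h ▸ he)⟩⟩
    · rintro ⟨h1, h2⟩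
      exact ⟨h1, fun h => (h2 x h).2 rfl⟩
  | succ t ih =>
    simp only [IIM.cascade_succ_iff, mem_singleton, notMem_empty, not_false_eq_true, true_and]
    constructor
    · rintro ⟨h1, h2⟩
      refine ⟨h2.imp id fun h3 => ⟨h3.1, fun s hs => ?_⟩, fun e he =>
        ⟨fun h => h1 (h ▸ he), h2.imp id fun h3 => ⟨h3.1, fun s hs => ?_⟩⟩⟩
      · obtain ⟨d, hd, hds⟩ := h3.2 s hs
        exact ⟨d, ((ih d).1 hd).1, hds⟩
      · obtain ⟨d, hd, hds⟩ := h3.2 s hs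
        exact ⟨d, ((ih d).1 hd).2 e he, hds⟩
    · rintro ⟨h1, h2⟩
      refine ⟨fun h => (h2 x h).1 rfl, ?_⟩
      by_cases hS : x ∈ S
      · exact Or.inl hS
      · have h3 := h1.resolve_left hS
        refine Or.inr ⟨h3.1, fun s hs => ?_⟩
        obtain ⟨q, rfl⟩ := card_eq_one.1 (hres x s hs)
        refine ⟨q, (ih q).2 ⟨?_, fun e he => ?_⟩, mem_singleton_self q⟩
        · obtain ⟨d, hd, hds⟩ := h3.2 _ hs
          exact mem_singleton.1 hds ▸ hd
        · obtain ⟨d, hd, hds⟩ := ((h2 e he).2.resolve_left hS).2 _ hs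
          exact mem_singleton.1 hds ▸ hd

/-- In a system satisfying Restricted Case II with initial
failure set `E'`, for every hardened set `X ⊆ E`:
`P(X|E') = ⋃_{e ∈ X} P(e|E')`. -/
theorem protSet_biUnion {α : Type*} [Fintype α] [DecidableEq α]
    (sys : IIM α) (hres : sys.RestrictedII) (E' X : Finset α) :
    sys.protSet X E' = X.biUnion (fun e => sys.protSet {e} E') := by
  ext x
  simp only [IIM.protSet, IIM.killSet, IIM.killSetH, mem_sdiff, mem_biUnion]
  rw [IIM.cascade_inter sys hres E' X]
  constructor
  · rintro ⟨h1, h2⟩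
    by_contra hc
    exact h2 ⟨h1, fun e he => by_contra fun h => hc ⟨e, he, h1, h⟩⟩
  · rintro ⟨e, he, h1, h2⟩
    exact ⟨h1, fun h => h2 (h.2 e he)⟩
end

section
/- Correctness of the reduction from Set Cover to Targeted Entity Hardening: let U = {x_1, …, x_n} be a finite set and 𝒮 = {S_1, …, S_m} a family of subsets of U whose union is U, and construct the system whose entity set is the disjoint union of A = {a_i : x_i ∈ U} and B = {b_j : S_j ∈ 𝒮}, where each a_i has the IDR a_i ← Σ_{j : x_i ∈ S_j} b_j (one size-one minterm {b_j} for each j with x_i ∈ S_j) and the b_j have no IDRs; let the initial failure set be E' = B and the protection target be P = A. Then for any positive integer M ≤ m: there exists a hardening set H with |H| ≤ M such that KillSet_H(E') ∩ A = ∅ if and only if there exist at most M subsets in 𝒮 whose union equals U. -/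
open Finset

/-- The system built from a Set Cover instance `(U, 𝒮)` (with `U` the type
`β`): entities are the disjoint union of `A = {a_x : x ∈ U}` (elements
`Sum.inl x`) and `B = {b_S : S ∈ 𝒮}` (elements `Sum.inr S`); each `a_x` has
the IDR `a_x ← Σ_{S ∈ 𝒮, x ∈ S} b_S` (one size-one minterm `{b_S}` for each
`S ∈ 𝒮` containing `x`), and the `b_S` have no IDRs. -/
def setCoverSys (β : Type*) [Fintype β] [DecidableEq β]
    (𝒮 : Finset (Finset β)) : IIM (β ⊕ {S : Finset β // S ∈ 𝒮}) where
  idr x :=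
    match x with
    | Sum.inl a =>
        (𝒮.attach.filter fun S => a ∈ S.1).image
          fun S => ({Sum.inr S} : Finset (β ⊕ {S : Finset β // S ∈ 𝒮}))
    | Sum.inr _ => ∅
  minterm_nonempty := by
    rintro (a | S) s hs
    · simp only [Finset.mem_image] at hs
      obtain ⟨T, -, rfl⟩ := hs
      exact Finset.singleton_nonempty _
    · simp at hs
  minterm_not_self := by
    rintro (a | S) s hs
    · simp only [Finset.mem_image] at hs
      obtain ⟨T, -, rfl⟩ := hs
      simp
    · simp at hs

theorem IIM.cascade_mono_aux {α : Type*} [Fintype α] [DecidableEq α] (sys : IIM α)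
    (S H : Finset α) : Monotone (sys.cascade S H) := by
  refine monotone_nat_of_le_succ fun t => ?_
  rw [IIM.cascade]
  exact Finset.subset_union_left

theorem IIM.cascade_disjoint_aux {α : Type*} [Fintype α] [DecidableEq α] (sys : IIM α)
    (S H : Finset α) (t : ℕ) : ∀ e ∈ sys.cascade S H t, e ∉ H := by
  induction t with
  | zero =>
    intro e he
    rw [IIM.cascade] at he
    exact (Finset.mem_sdiff.1 he).2
  | succ t ih =>
    intro e he
    rw [IIM.cascade] at he
    rcases Finset.mem_union.1 he with h | h
    · exact ih e h
    · exact (Finset.mem_filter.1 h).2.1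

/-- Correctness of the reduction from Set Cover to Targeted
Entity Hardening: with the union of `𝒮` equal to `U`, initial failure set
`E' = B = {b_S : S ∈ 𝒮}` and protection target `P = A = {a_x : x ∈ U}`, for
any positive integer `M ≤ |𝒮|`, there is a hardening set `H` with `|H| ≤ M`
and `KillSet_H(E') ∩ A = ∅` iff at most `M` subsets in `𝒮` have union `U`. -/
theorem setCover_TEH_reduction {β : Type*} [Fintype β] [DecidableEq β]
    (𝒮 : Finset (Finset β)) (hcov : ∀ x : β, ∃ S ∈ 𝒮, x ∈ S)
    (M : ℕ) (hM : 0 < M) (hMm : M ≤ 𝒮.card) :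
    (∃ H : Finset (β ⊕ {S : Finset β // S ∈ 𝒮}), H.card ≤ M ∧
      (setCoverSys β 𝒮).killSetH (𝒮.attach.image fun S => Sum.inr S) H ∩
        (Finset.univ.image Sum.inl) = ∅) ↔
    (∃ 𝒮' ⊆ 𝒮, 𝒮'.card ≤ M ∧ ∀ x : β, ∃ S ∈ 𝒮', x ∈ S) := by
  constructor
  · rintro ⟨H, hH, hK⟩
    choose c hc hxc using hcov
    refine ⟨H.image (Sum.elim c Subtype.val), ?_, Finset.card_image_le.trans hH, ?_⟩
    · intro T hT
      obtain ⟨y, -, rfl⟩ := Finset.mem_image.1 hT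
      rcases y with a | S
      · exact hc a
      · exact S.2
    · intro x
      by_contra hno
      have h1 : Sum.inl x ∉ H := fun h =>
        hno ⟨c x, Finset.mem_image.2 ⟨_, h, rfl⟩, hxc x⟩
      have h2 : ∀ S : {S : Finset β // S ∈ 𝒮}, x ∈ S.1 → Sum.inr S ∉ H := fun S hS h =>
        hno ⟨S.1, Finset.mem_image.2 ⟨_, h, rfl⟩, hS⟩
      have hcard : 1 ≤ Fintype.card (β ⊕ {S : Finset β // S ∈ 𝒮}) - 1 := by
        have ha : 0 < Fintype.card β := Fintype.card_pos_iff.2 ⟨x⟩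
        have hb : 0 < Fintype.card {S : Finset β // S ∈ 𝒮} :=
          Fintype.card_pos_iff.2 ⟨⟨c x, hc x⟩⟩
        rw [Fintype.card_sum]
        omega
      have hmem : Sum.inl x ∈
          (setCoverSys β 𝒮).cascade (𝒮.attach.image fun S => Sum.inr S) H 1 := by
        rw [IIM.cascade]
        refine Finset.mem_union_right _ (Finset.mem_filter.2 ⟨Finset.mem_univ _, h1, ?_, ?_⟩)
        · exact ⟨{Sum.inr ⟨c x, hc x⟩}, Finset.mem_image.2
            ⟨⟨c x, hc x⟩, Finset.mem_filter.2 ⟨Finset.mem_attach _ _, hxc x⟩, rfl⟩⟩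
        · intro s hs
          obtain ⟨T, hT, rfl⟩ := Finset.mem_image.1 hs
          refine ⟨Sum.inr T, ?_, Finset.mem_singleton_self _⟩
          rw [IIM.cascade]
          exact Finset.mem_sdiff.2 ⟨Finset.mem_image.2 ⟨T, Finset.mem_attach _ _, rfl⟩,
            h2 T (Finset.mem_filter.1 hT).2⟩
      have hk := IIM.cascade_mono_aux (setCoverSys β 𝒮) _ H hcard hmem
      have : (Sum.inl x : β ⊕ {S : Finset β // S ∈ 𝒮}) ∈ (∅ : Finset _) := by
        rw [← hK]
        exact Finset.mem_inter.2 ⟨hk, Finset.mem_image.2 ⟨x, Finset.mem_univ _, rfl⟩⟩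
      exact absurd this (Finset.notMem_empty _)
  · rintro ⟨T, hT, hTM, hcT⟩
    refine ⟨T.attach.image fun S => Sum.inr ⟨S.1, hT S.2⟩,
      Finset.card_image_le.trans (by rwa [Finset.card_attach]), ?_⟩
    rw [Finset.eq_empty_iff_forall_notMem]
    intro e he
    obtain ⟨hk, hl⟩ := Finset.mem_inter.1 he
    obtain ⟨x, -, rfl⟩ := Finset.mem_image.1 hl
    rw [IIM.killSetH] at hk
    generalize Fintype.card (β ⊕ {S : Finset β // S ∈ 𝒮}) - 1 = t at hk
    clear he hl
    induction t with
    | zero =>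
      rw [IIM.cascade] at hk
      obtain ⟨S, -, hS⟩ := Finset.mem_image.1 (Finset.mem_sdiff.1 hk).1
      cases hS
    | succ t ih =>
      rw [IIM.cascade] at hk
      rcases Finset.mem_union.1 hk with h | h
      · exact ih h
      · obtain ⟨S, hS, hxS⟩ := hcT x
        obtain ⟨d, hd, hds⟩ := (Finset.mem_filter.1 h).2.2.2 {Sum.inr ⟨S, hT hS⟩}
          (Finset.mem_image.2 ⟨⟨S, hT hS⟩,
            Finset.mem_filter.2 ⟨Finset.mem_attach _ _, hxS⟩, rfl⟩)
        rw [Finset.mem_singleton] at hds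
        subst hds
        exact IIM.cascade_disjoint_aux _ _ _ t _ hd
          (Finset.mem_image.2 ⟨⟨S, hS⟩, Finset.mem_attach _ _, rfl⟩)
end

section
/- In a system satisfying Restricted Case II with initial failure set E' ⊆ E and a target set P ⊆ KillSet(E') of entities to be protected, a hardened set H protects all entities of P (i.e., KillSet_H(E') ∩ P = ∅) if and only if P ⊆ ⋃_{e ∈ H} P(e|E'); consequently, the minimum cardinality of a hardened set protecting all of P equals the minimum cardinality of a subfamily of the protection sets {P(e|E') : e ∈ E} whose union covers P. -/
open Finset

namespace IIM

theorem cascade_succ {α : Type*} [Fintype α] [DecidableEq α] (sys : IIM α) (S H : Finset α)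
    (t : ℕ) (x : α) : x ∈ sys.cascade S H (t + 1) ↔ x ∈ sys.cascade S H t ∨
      (x ∉ H ∧ (sys.idr x).Nonempty ∧ ∀ s ∈ sys.idr x, ∃ d ∈ sys.cascade S H t, d ∈ s) := by
  simp [cascade]

theorem cascade_mono {α : Type*} [Fintype α] [DecidableEq α] (sys : IIM α) (S H : Finset α) :
    Monotone (sys.cascade S H) :=
  monotone_nat_of_le_succ fun t x hx => (sys.cascade_succ S H t x).2 (Or.inl hx)

theorem cascade_card {α : Type*} [Fintype α] [DecidableEq α] (sys : IIM α) (S H : Finset α)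
    (t : ℕ) (h : sys.cascade S H (t + 1) ≠ sys.cascade S H t) :
    t + 2 ≤ (sys.cascade S H (t + 1)).card := by
  have hlt : ∀ k, sys.cascade S H (k + 1) ≠ sys.cascade S H k →
      (sys.cascade S H k).card < (sys.cascade S H (k + 1)).card := fun k hk =>
    Finset.card_lt_card (lt_of_le_of_ne (sys.cascade_mono S H (Nat.le_succ k)) hk.symm)
  induction t with
  | zero =>
    have h1 := hlt 0 h
    have h2 : 0 < (sys.cascade S H 0).card := by
      rw [Finset.card_pos, Finset.nonempty_iff_ne_empty]
      intro h0
      apply h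
      ext x
      rw [cascade_succ, h0]
      constructor
      · rintro (hx | ⟨_, ⟨s, hs⟩, hx⟩)
        · exact hx
        · obtain ⟨d, hd, _⟩ := hx s hs
          simp at hd
      · exact Or.inl
    omega
  | succ t ih =>
    have h1 := hlt _ h
    have h2 : sys.cascade S H (t + 1) ≠ sys.cascade S H t := by
      intro h0
      apply h
      ext x
      rw [cascade_succ, h0, ← cascade_succ, h0]
    have := ih h2
    omega

theorem killSetH_stable {α : Type*} [Fintype α] [DecidableEq α] (sys : IIM α) (S H : Finset α) :
    sys.cascade S H (Fintype.card α - 1 + 1) = sys.killSetH S H := by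
  by_contra h
  have h1 := sys.cascade_card S H _ h
  have h2 := Finset.card_le_univ (sys.cascade S H (Fintype.card α - 1 + 1))
  omega

theorem cascade_anti {α : Type*} [Fintype α] [DecidableEq α] (sys : IIM α) (S : Finset α)
    {H H' : Finset α} (hH : H ⊆ H') (t : ℕ) : sys.cascade S H' t ⊆ sys.cascade S H t := by
  induction t with
  | zero => exact Finset.sdiff_subset_sdiff (Finset.Subset.refl S) hH
  | succ t ih =>
    intro x
    rw [cascade_succ, cascade_succ]
    rintro (hx | ⟨h1, h2, h3⟩)
    · exact Or.inl (ih hx)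
    · refine Or.inr ⟨fun h => h1 (hH h), h2, fun s hs => ?_⟩
      obtain ⟨d, hd, hds⟩ := h3 s hs
      exact ⟨d, ih hd, hds⟩

theorem not_mem_cascade {α : Type*} [Fintype α] [DecidableEq α] (sys : IIM α) (S H : Finset α)
    {x : α} (hx : x ∈ H) (t : ℕ) : x ∉ sys.cascade S H t := by
  induction t with
  | zero => simp [cascade, hx]
  | succ t ih => rw [cascade_succ]; tauto

theorem exists_protector {α : Type*} [Fintype α] [DecidableEq α] (sys : IIM α)
    (hres : sys.RestrictedII) (S H : Finset α) (t : ℕ) :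
    ∀ x ∈ sys.cascade S ∅ t, x ∉ sys.killSetH S H → ∃ h ∈ H, x ∉ sys.killSetH S {h} := by
  induction t with
  | zero =>
    intro x hx hn
    by_cases hH : x ∈ H
    · exact ⟨x, hH, sys.not_mem_cascade S {x} (by simp) _⟩
    · refine absurd (sys.cascade_mono S H (Nat.zero_le _) ?_) hn
      simp only [cascade, Finset.mem_sdiff] at hx ⊢
      exact ⟨hx.1, hH⟩
  | succ t ih =>
    intro x hx hn
    by_cases hH : x ∈ H
    · exact ⟨x, hH, sys.not_mem_cascade S {x} (by simp) _⟩
    rw [cascade_succ] at hx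
    rcases hx with hx | ⟨_, hne, hall⟩
    · exact ih x hx hn
    have hn' := hn
    rw [← killSetH_stable, cascade_succ] at hn'
    push Not at hn'
    obtain ⟨s, hs, hsn⟩ := hn'.2 hH hne
    obtain ⟨y, rfl⟩ := Finset.card_eq_one.1 (hres x s hs)
    obtain ⟨d, hd, hdy⟩ := hall _ hs
    obtain rfl := Finset.mem_singleton.1 hdy
    obtain ⟨h, hh, hk⟩ := ih d hd fun hmem => hsn d hmem (by simp)
    refine ⟨h, hh, ?_⟩
    have hxS : x ∉ S := fun hxS => hn (sys.cascade_mono S H (Nat.zero_le _) (by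
      simp only [cascade, Finset.mem_sdiff]
      exact ⟨hxS, hH⟩))
    have key : ∀ k, k ≤ Fintype.card α - 1 → x ∉ sys.cascade S {h} k := by
      intro k
      induction k with
      | zero => intro _; simp [cascade, hxS]
      | succ k ihk =>
        intro hkle
        rw [cascade_succ]
        rintro (h1 | ⟨_, _, h3⟩)
        · exact ihk (by omega) h1
        · obtain ⟨d', hd', hdd⟩ := h3 _ hs
          obtain rfl := Finset.mem_singleton.1 hdd
          exact hk (sys.cascade_mono S {h} (by omega) hd')
    exact key _ le_rfl

end IIM

/-- In a system satisfying Restricted Case II with initial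
failure set `E'` and target set `P ⊆ KillSet(E')`, a hardened set `H` protects
all entities of `P` (`KillSet_H(E') ∩ P = ∅`) iff `P ⊆ ⋃_{e ∈ H} P(e|E')`;
consequently the minimum cardinality of a hardened set protecting all of `P`
equals the minimum cardinality of a subfamily of the protection sets
`{P(e|E') : e ∈ E}` whose union covers `P`. -/
theorem targeted_hardening_iff_cover {α : Type*} [Fintype α] [DecidableEq α]
    (sys : IIM α) (hres : sys.RestrictedII) (E' P : Finset α)
    (hP : P ⊆ sys.killSet E') :
    (∀ H : Finset α,
      sys.killSetH E' H ∩ P = ∅ ↔ P ⊆ H.biUnion fun e => sys.protSet {e} E') ∧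
    sInf {n : ℕ | ∃ H : Finset α, H.card = n ∧ sys.killSetH E' H ∩ P = ∅} =
      sInf {n : ℕ | ∃ X : Finset α, X.card = n ∧
        P ⊆ X.biUnion fun e => sys.protSet {e} E'} := by
  have main : ∀ H : Finset α,
      sys.killSetH E' H ∩ P = ∅ ↔ P ⊆ H.biUnion fun e => sys.protSet {e} E' := by
    intro H
    constructor
    · intro h x hx
      have hn : x ∉ sys.killSetH E' H := fun hk => by
        have : x ∈ sys.killSetH E' H ∩ P := Finset.mem_inter.2 ⟨hk, hx⟩
        simp [h] at this
      obtain ⟨e, he, hk⟩ := sys.exists_protector hres E' H _ x (hP hx) hn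
      exact Finset.mem_biUnion.2 ⟨e, he, Finset.mem_sdiff.2 ⟨hP hx, hk⟩⟩
    · intro h
      rw [Finset.eq_empty_iff_forall_notMem]
      intro x hx
      obtain ⟨hk, hxP⟩ := Finset.mem_inter.1 hx
      obtain ⟨e, he, hm⟩ := Finset.mem_biUnion.1 (h hxP)
      exact (Finset.mem_sdiff.1 hm).2
        (sys.cascade_anti E' (Finset.singleton_subset_iff.2 he) _ hk)
  refine ⟨main, ?_⟩
  simp only [main]
end
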